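/- arXiv:2511.06047 — 6 statements merged into one kernel-verified Lean document; each statement's English description precedes it below -/
import Mathlib

section
/- Let U, V ∈ D_m. Then p(U) = p(V) if and only if there exist unitary m×m matrices g_1, …, g_{k+1} such that V = U·g, where g ∈ U(n) is the block-diagonal matrix whose j-th diagonal block is g_j. -/
open Matrix

/-- The `(ℓ,j)` block of size `m × m` of an `n × n` matrix, `n = (k+1)m`. -/
def blk {k m : ℕ} (U : Matrix (Fin (k+1) × Fin m) (Fin (k+1) × Fin m) ℂ)
    (ℓ j : Fin (k+1)) : Matrix (Fin m) (Fin m) ℂ :=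
  fun a b => U (ℓ, a) (j, b)

/-- The first `k` blocks of column `j`, stacked vertically. -/
def stk {k m : ℕ} (U : Matrix (Fin (k+1) × Fin m) (Fin (k+1) × Fin m) ℂ)
    (j : Fin (k+1)) : Matrix (Fin k × Fin m) (Fin m) ℂ :=
  fun x b => U (x.1.castSucc, x.2) (j, b)

/-- The affine coordinates `w_j = (stack of U_{1j},…,U_{kj}) · U_{(k+1)j}⁻¹`. -/
noncomputable def affine {k m : ℕ} (U : Matrix (Fin (k+1) × Fin m) (Fin (k+1) × Fin m) ℂ)
    (j : Fin (k+1)) : Matrix (Fin k × Fin m) (Fin m) ℂ :=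
  stk U j * (blk U (Fin.last k) j)⁻¹

/-- The block-diagonal matrix with diagonal blocks `g 1, …, g (k+1)`. -/
def blkDiag {k m : ℕ} (g : Fin (k+1) → Matrix (Fin m) (Fin m) ℂ) :
    Matrix (Fin (k+1) × Fin m) (Fin (k+1) × Fin m) ℂ :=
  fun x y => if x.1 = y.1 then g x.1 x.2 y.2 else 0

theorem mul_blkDiag_apply {k m : ℕ} (U : Matrix (Fin (k+1) × Fin m) (Fin (k+1) × Fin m) ℂ)
    (g : Fin (k+1) → Matrix (Fin m) (Fin m) ℂ) (x : Fin (k+1) × Fin m) (j : Fin (k+1))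
    (b : Fin m) : (U * blkDiag g) x (j, b) = ∑ c, U x (j, c) * g j c b := by
  rw [Matrix.mul_apply, Fintype.sum_prod_type]
  simp [blkDiag, mul_ite, Finset.sum_ite_irrel]

theorem blk_mul_blkDiag {k m : ℕ} (U : Matrix (Fin (k+1) × Fin m) (Fin (k+1) × Fin m) ℂ)
    (g : Fin (k+1) → Matrix (Fin m) (Fin m) ℂ) (l j : Fin (k+1)) :
    blk (U * blkDiag g) l j = blk U l j * g j := by
  ext a b
  exact mul_blkDiag_apply U g (l, a) j b

theorem stk_mul_blkDiag {k m : ℕ} (U : Matrix (Fin (k+1) × Fin m) (Fin (k+1) × Fin m) ℂ)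
    (g : Fin (k+1) → Matrix (Fin m) (Fin m) ℂ) (j : Fin (k+1)) :
    stk (U * blkDiag g) j = stk U j * g j := by
  ext x b
  exact mul_blkDiag_apply U g (x.1.castSucc, x.2) j b

/-- `p(U) = p(V)` iff `V = U g` for some block-diagonal unitary `g ∈ U(m)^{k+1}`. -/
theorem affine_eq_iff_blockDiag_unitary (k m : ℕ) (hk : 1 ≤ k) (hm : 1 ≤ m)
    (U V : Matrix (Fin (k+1) × Fin m) (Fin (k+1) × Fin m) ℂ)
    (hU : Uᴴ * U = 1) (hV : Vᴴ * V = 1)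
    (hUd : ∀ j, IsUnit (blk U (Fin.last k) j).det)
    (hVd : ∀ j, IsUnit (blk V (Fin.last k) j).det) :
    (∀ j, affine U j = affine V j) ↔
      ∃ g : Fin (k+1) → Matrix (Fin m) (Fin m) ℂ,
        (∀ j, (g j)ᴴ * g j = 1) ∧ V = U * blkDiag g := by
  constructor
  · intro h
    have hVg : V = U * blkDiag (fun j => (blk U (Fin.last k) j)⁻¹ * blk V (Fin.last k) j) := by
      ext ⟨l, a⟩ ⟨j, b⟩
      refine Fin.lastCases ?_ (fun i => ?_) l
      · have := blk_mul_blkDiag U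
          (fun j => (blk U (Fin.last k) j)⁻¹ * blk V (Fin.last k) j) (Fin.last k) j
        rw [← Matrix.mul_assoc, Matrix.mul_nonsing_inv _ (hUd j), Matrix.one_mul] at this
        exact (congrFun (congrFun this a) b).symm
      · have := stk_mul_blkDiag U
          (fun j => (blk U (Fin.last k) j)⁻¹ * blk V (Fin.last k) j) j
        have h2 : stk U j * (blk U (Fin.last k) j)⁻¹ = stk V j * (blk V (Fin.last k) j)⁻¹ := h j
        rw [← Matrix.mul_assoc, h2, Matrix.mul_assoc, Matrix.nonsing_inv_mul _ (hVd j),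
          Matrix.mul_one] at this
        exact (congrFun (congrFun this (i, a)) b).symm
    obtain ⟨g, hVg⟩ : ∃ g, V = U * blkDiag g := ⟨_, hVg⟩
    refine ⟨g, fun j => ?_, hVg⟩
    have h1 : (blkDiag g)ᴴ * blkDiag g = 1 := by
      rw [hVg, Matrix.conjTranspose_mul, Matrix.mul_assoc, ← Matrix.mul_assoc Uᴴ, hU,
        Matrix.one_mul] at hV
      exact hV
    ext a b
    have h2 := congrFun (congrFun h1 (j, a)) (j, b)
    rw [mul_blkDiag_apply] at h2
    simpa [Matrix.mul_apply, Matrix.one_apply, blkDiag] using h2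
  · rintro ⟨g, hg, rfl⟩ j
    have hg' : g j * (g j)⁻¹ = 1 := by
      rw [Matrix.inv_eq_left_inv (hg j)]
      exact mul_eq_one_comm.mp (hg j)
    rw [affine, affine, blk_mul_blkDiag, stk_mul_blkDiag, Matrix.mul_inv_rev, Matrix.mul_assoc,
      ← Matrix.mul_assoc (g j), hg', Matrix.one_mul]
end

section
/- If U ∈ D_m and (w_1,…,w_{k+1}) = p(U), then w_j* w_ℓ = −I_m for all 1 ≤ j ≠ ℓ ≤ k+1; that is, p(U) ∈ O_m. -/
open Matrix

/-- If `U ∈ D_m` then its affine coordinates satisfy `w_j* w_ℓ = −I_m` for `j ≠ ℓ`,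
i.e. `p(U) ∈ O_m`. -/
theorem affine_mem_Om (k m : ℕ) (hk : 1 ≤ k) (hm : 1 ≤ m)
    (U : Matrix (Fin (k+1) × Fin m) (Fin (k+1) × Fin m) ℂ)
    (hU : Uᴴ * U = 1)
    (hUd : ∀ j, IsUnit (blk U (Fin.last k) j).det) :
    ∀ j ℓ : Fin (k+1), j ≠ ℓ → (affine U j)ᴴ * affine U ℓ = -1 := by
  intro j ℓ hjl
  have key : (stk U j)ᴴ * stk U ℓ
      = -((blk U (Fin.last k) j)ᴴ * blk U (Fin.last k) ℓ) := by
    ext a b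
    have h := congrFun (congrFun hU (j, a)) (ℓ, b)
    have hne : (j, a) ≠ (ℓ, b) := fun h => hjl (congrArg Prod.fst h)
    rw [Matrix.one_apply_ne hne, Matrix.mul_apply, Fintype.sum_prod_type,
      Fin.sum_univ_castSucc] at h
    rw [Matrix.neg_apply, Matrix.mul_apply, Matrix.mul_apply, Fintype.sum_prod_type]
    exact eq_neg_of_add_eq_zero_left h
  have hj : ((blk U (Fin.last k) j)⁻¹)ᴴ * (blk U (Fin.last k) j)ᴴ = 1 := by
    rw [← Matrix.conjTranspose_mul, Matrix.mul_nonsing_inv _ (hUd j),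
      Matrix.conjTranspose_one]
  have hl := Matrix.mul_nonsing_inv _ (hUd ℓ)
  unfold affine
  rw [Matrix.conjTranspose_mul]
  calc _ = ((blk U (Fin.last k) j)⁻¹)ᴴ * ((stk U j)ᴴ * stk U ℓ)
        * (blk U (Fin.last k) ℓ)⁻¹ := by simp only [Matrix.mul_assoc]
    _ = -((((blk U (Fin.last k) j)⁻¹)ᴴ * (blk U (Fin.last k) j)ᴴ)
        * (blk U (Fin.last k) ℓ * (blk U (Fin.last k) ℓ)⁻¹)) := by
      rw [key]; simp only [Matrix.mul_assoc, Matrix.mul_neg, Matrix.neg_mul]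
    _ = -1 := by rw [hj, hl, Matrix.one_mul]
end

section
/- Let (w_1,…,w_{k+1}) ∈ O_m and θ_1,…,θ_{k+1} ∈ ℝ. For each j the matrix I_m + w_j* w_j is Hermitian positive definite; let S_j := (I_m + w_j* w_j)^{-1/2} be the inverse of its positive definite square root. Define the n×n complex matrix M whose j-th block column is e^{iθ_j/m} times the n×m matrix obtained by stacking w_j on top of I_m, multiplied on the right by S_j (explicitly, the block M_{ℓj} is e^{iθ_j/m}·(w_j)_ℓ·S_j for 1 ≤ ℓ ≤ k, where (w_j)_ℓ is the ℓ-th m×m block of w_j, and M_{(k+1)j} = e^{iθ_j/m}·S_j). Then M is unitary, M ∈ D_m, and p(M) = (w_1,…,w_{k+1}). -/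
open Matrix ComplexOrder

/-- The matrix of the trivialisation: block `M_{ℓj} = e^{iθ_j/m} (w_j)_ℓ S_j` for
`ℓ ≤ k` and `M_{(k+1)j} = e^{iθ_j/m} S_j`. -/
noncomputable def trivMat {k m : ℕ} (θ : Fin (k+1) → ℝ)
    (w : Fin (k+1) → Matrix (Fin k × Fin m) (Fin m) ℂ)
    (S : Fin (k+1) → Matrix (Fin m) (Fin m) ℂ) :
    Matrix (Fin (k+1) × Fin m) (Fin (k+1) × Fin m) ℂ :=
  fun x y => Complex.exp (Complex.I * (θ y.1 : ℂ) / (m : ℂ)) *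
    (if h : x.1 = Fin.last k then S y.1 x.2 y.2
     else (w y.1 * S y.1) (x.1.castPred h, x.2) y.2)

theorem tm_last {k m : ℕ} (θ : Fin (k+1) → ℝ)
    (w : Fin (k+1) → Matrix (Fin k × Fin m) (Fin m) ℂ)
    (S : Fin (k+1) → Matrix (Fin m) (Fin m) ℂ) (j : Fin (k+1)) (a b : Fin m) :
    trivMat θ w S (Fin.last k, a) (j, b) =
      Complex.exp (Complex.I * (θ j : ℂ) / (m : ℂ)) * S j a b := by
  simp [trivMat]

theorem tm_cast {k m : ℕ} (θ : Fin (k+1) → ℝ)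
    (w : Fin (k+1) → Matrix (Fin k × Fin m) (Fin m) ℂ)
    (S : Fin (k+1) → Matrix (Fin m) (Fin m) ℂ) (j : Fin (k+1)) (i : Fin k) (a b : Fin m) :
    trivMat θ w S (i.castSucc, a) (j, b) =
      Complex.exp (Complex.I * (θ j : ℂ) / (m : ℂ)) * (w j * S j) (i, a) b := by
  simp [trivMat, Fin.castSucc_ne_last]

theorem tm_gram {k m : ℕ} (θ : Fin (k+1) → ℝ)
    (w : Fin (k+1) → Matrix (Fin k × Fin m) (Fin m) ℂ)
    (S : Fin (k+1) → Matrix (Fin m) (Fin m) ℂ) (j l : Fin (k+1)) (a b : Fin m) :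
    ((trivMat θ w S)ᴴ * trivMat θ w S) (j, a) (l, b) =
      star (Complex.exp (Complex.I * (θ j : ℂ) / (m : ℂ))) *
        Complex.exp (Complex.I * (θ l : ℂ) / (m : ℂ)) *
        ((S j)ᴴ * (1 + (w j)ᴴ * w l) * S l : Matrix (Fin m) (Fin m) ℂ) a b := by
  have h : (S j)ᴴ * (1 + (w j)ᴴ * w l) * S l = (w j * S j)ᴴ * (w l * S l) + (S j)ᴴ * S l := by
    rw [Matrix.conjTranspose_mul]
    simp only [Matrix.mul_add, Matrix.add_mul, Matrix.mul_assoc, Matrix.mul_one, Matrix.one_mul]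
    rw [add_comm]
  rw [h, Matrix.add_apply, Matrix.mul_apply, Matrix.mul_apply, Matrix.mul_apply,
    Fintype.sum_prod_type, Fintype.sum_prod_type, Fin.sum_univ_castSucc, mul_add]
  simp only [Matrix.conjTranspose_apply, tm_last, tm_cast, star_mul', Finset.mul_sum]
  congr 1
  · refine Finset.sum_congr rfl fun i _ => Finset.sum_congr rfl fun c _ => ?_
    ring
  · refine Finset.sum_congr rfl fun c _ => ?_
    ring

theorem tm_phase (t : ℝ) (m : ℕ) :
    star (Complex.exp (Complex.I * (t : ℂ) / (m : ℂ))) *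
        Complex.exp (Complex.I * (t : ℂ) / (m : ℂ)) = 1 := by
  rw [Complex.star_def, ← Complex.exp_conj, ← Complex.exp_add]
  simp [neg_div]

/-- For `w ∈ O_m` and angles `θ`, the matrix of the trivialisation is unitary,
lies in `D_m`, and has affine coordinates `w`.  Here `S_j`, characterised as the
positive definite matrix with `S_j² = (I_m + w_j* w_j)⁻¹`, is the inverse of the
positive definite square root of `I_m + w_j* w_j`. -/
theorem trivMat_unitary_affine (k m : ℕ) (hk : 1 ≤ k) (hm : 1 ≤ m)
    (w : Fin (k+1) → Matrix (Fin k × Fin m) (Fin m) ℂ)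
    (hw : ∀ j ℓ : Fin (k+1), j ≠ ℓ → (w j)ᴴ * w ℓ = -1)
    (θ : Fin (k+1) → ℝ)
    (S : Fin (k+1) → Matrix (Fin m) (Fin m) ℂ)
    (hS : ∀ j, (S j).PosDef ∧ S j * S j = (1 + (w j)ᴴ * w j)⁻¹) :
    (∀ j, ((1 : Matrix (Fin m) (Fin m) ℂ) + (w j)ᴴ * w j).PosDef) ∧
    (trivMat θ w S)ᴴ * trivMat θ w S = 1 ∧
    (∀ j, IsUnit (blk (trivMat θ w S) (Fin.last k) j).det) ∧
    (∀ j, affine (trivMat θ w S) j = w j) := by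
  have hP : ∀ j, ((1 : Matrix (Fin m) (Fin m) ℂ) + (w j)ᴴ * w j).PosDef := fun j =>
    Matrix.PosDef.one.add_posSemidef (Matrix.posSemidef_conjTranspose_mul_self (w j))
  have hSu : ∀ j, IsUnit (S j).det := fun j =>
    (Matrix.isUnit_iff_isUnit_det _).1 (hS j).1.isUnit
  have hb : ∀ j, blk (trivMat θ w S) (Fin.last k) j =
      Complex.exp (Complex.I * (θ j : ℂ) / (m : ℂ)) • S j := by
    intro j
    ext a b
    simp [blk, tm_last]
  have hs : ∀ j, stk (trivMat θ w S) j =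
      w j * (Complex.exp (Complex.I * (θ j : ℂ) / (m : ℂ)) • S j) := by
    intro j
    rw [Matrix.mul_smul]
    ext x b
    simp [stk, tm_cast]
  have hu : ∀ j, IsUnit (blk (trivMat θ w S) (Fin.last k) j).det := by
    intro j
    rw [hb, Matrix.det_smul]
    exact ((isUnit_iff_ne_zero.2 (Complex.exp_ne_zero _)).pow _).mul (hSu j)
  refine ⟨hP, ?_, hu, ?_⟩
  · ext ⟨j, a⟩ ⟨l, b⟩
    rw [tm_gram]
    by_cases hjl : j = l
    · subst hjl
      have hPu := (Matrix.isUnit_iff_isUnit_det _).1 (hP j).isUnit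
      have h1 : S j * (S j * (1 + (w j)ᴴ * w j)) = 1 := by
        rw [← Matrix.mul_assoc, (hS j).2, Matrix.nonsing_inv_mul _ hPu]
      have h2 := mul_eq_one_comm.1 h1
      rw [tm_phase, (hS j).1.isHermitian.eq, h2]
      simp [Matrix.one_apply]
    · rw [hw j l hjl]
      simp [Matrix.one_apply, hjl]
  · intro j
    have := hu j
    rw [hb] at this
    rw [affine, hs, hb, Matrix.mul_nonsing_inv_cancel_right _ _ this]
end

section
/- The image of the set D_m under the affine-coordinate map p equals O_m; that is, p(D_m) = {(w_1,…,w_{k+1}) ∈ (ℂ^{(n−m)×m})^{k+1} : w_j* w_ℓ = −I_m for all 1 ≤ j ≠ ℓ ≤ k+1}. -/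
open Matrix

theorem gram_block {k m : ℕ} (U : Matrix (Fin (k+1) × Fin m) (Fin (k+1) × Fin m) ℂ)
    (j ℓ : Fin (k+1)) (a b : Fin m) :
    (Uᴴ * U) (j, a) (ℓ, b) = ((stk U j)ᴴ * stk U ℓ +
      (blk U (Fin.last k) j)ᴴ * blk U (Fin.last k) ℓ) a b := by
  simp [Matrix.mul_apply, stk, blk, Fintype.sum_prod_type, Fin.sum_univ_castSucc]

theorem gram_iff {k m : ℕ} (U : Matrix (Fin (k+1) × Fin m) (Fin (k+1) × Fin m) ℂ) :
    Uᴴ * U = 1 ↔ ∀ j ℓ, (stk U j)ᴴ * stk U ℓ +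
      (blk U (Fin.last k) j)ᴴ * blk U (Fin.last k) ℓ = if j = ℓ then 1 else 0 := by
  constructor
  · intro h j ℓ
    ext a b
    rw [← gram_block, h]
    by_cases hj : j = ℓ <;> simp [hj, Matrix.one_apply]
  · intro h
    ext ⟨j, a⟩ ⟨ℓ, b⟩
    rw [gram_block, h]
    by_cases hj : j = ℓ <;> simp [hj, Matrix.one_apply]

open scoped ComplexOrder MatrixOrder Matrix.Norms.L2Operator in
theorem exists_normalizer {ι m : Type*} [Fintype ι] [Fintype m] [DecidableEq m]
    (x : Matrix ι m ℂ) :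
    ∃ C : Matrix m m ℂ, IsUnit C.det ∧ Cᴴ * (xᴴ * x + 1) * C = 1 := by
  have hp : (xᴴ * x + 1).PosDef :=
    Matrix.PosDef.posSemidef_add (Matrix.posSemidef_conjTranspose_mul_self x) Matrix.PosDef.one
  obtain ⟨B, hB, he⟩ := CStarAlgebra.isStrictlyPositive_iff_eq_star_mul_self.mp hp.isStrictlyPositive
  rw [Matrix.star_eq_conjTranspose] at he
  have hd : IsUnit B.det := (Matrix.isUnit_iff_isUnit_det B).mp hB
  refine ⟨B⁻¹, Matrix.isUnit_nonsing_inv_det B hd, ?_⟩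
  have h1 : B * B⁻¹ = 1 := Matrix.mul_nonsing_inv B hd
  rw [he]
  calc (B⁻¹)ᴴ * (Bᴴ * B) * B⁻¹ = (B * B⁻¹)ᴴ * (B * B⁻¹) := by
        simp only [Matrix.conjTranspose_mul, Matrix.mul_assoc]
    _ = 1 := by simp [h1]

/-- The image of `D_m` under the affine coordinate map `p` is exactly `O_m`. -/
theorem image_affine_eq_Om (k m : ℕ) (hk : 1 ≤ k) (hm : 1 ≤ m) :
    {x : Fin (k+1) → Matrix (Fin k × Fin m) (Fin m) ℂ |
      ∃ U : Matrix (Fin (k+1) × Fin m) (Fin (k+1) × Fin m) ℂ,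
        Uᴴ * U = 1 ∧ (∀ j, IsUnit (blk U (Fin.last k) j).det) ∧
        ∀ j, affine U j = x j} =
    {x : Fin (k+1) → Matrix (Fin k × Fin m) (Fin m) ℂ |
      ∀ j ℓ : Fin (k+1), j ≠ ℓ → (x j)ᴴ * x ℓ = -1} := by
  ext x
  simp only [Set.mem_ofPred_eq]
  constructor
  · rintro ⟨U, hU, hd, hx⟩ j ℓ hj
    have h := (gram_iff U).mp hU j ℓ
    rw [if_neg hj] at h
    have h1 := Matrix.mul_nonsing_inv _ (hd j)
    have h2 := Matrix.mul_nonsing_inv _ (hd ℓ)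
    rw [← hx j, ← hx ℓ, affine, affine]
    generalize blk U (Fin.last k) j = B at *
    generalize blk U (Fin.last k) ℓ = D at *
    calc (stk U j * B⁻¹)ᴴ * (stk U ℓ * D⁻¹)
        = (B⁻¹)ᴴ * ((stk U j)ᴴ * stk U ℓ) * D⁻¹ := by
          simp only [Matrix.conjTranspose_mul, Matrix.mul_assoc]
      _ = -((B * B⁻¹)ᴴ * (D * D⁻¹)) := by
          rw [eq_neg_of_add_eq_zero_left h]
          simp only [Matrix.conjTranspose_mul, Matrix.mul_assoc, Matrix.mul_neg, Matrix.neg_mul]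
      _ = -1 := by simp [h1, h2]
  · intro hx
    choose C hC hn using fun j => exists_normalizer (x j)
    let U : Matrix (Fin (k+1) × Fin m) (Fin (k+1) × Fin m) ℂ := fun p q =>
      Fin.lastCases (motive := fun _ => ℂ) (C q.1 p.2 q.2)
        (fun i => (x q.1 * C q.1) (i, p.2) q.2) p.1
    have hb : ∀ j, blk U (Fin.last k) j = C j := by
      intro j; ext a b; simp [blk, U]
    have hs : ∀ j, stk U j = x j * C j := by
      intro j; ext a b; simp [stk, U]
    refine ⟨U, (gram_iff U).mpr ?_, ?_, ?_⟩
    · intro j ℓ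
      rw [hs, hs, hb, hb]
      have e : (x j * C j)ᴴ * (x ℓ * C ℓ) + (C j)ᴴ * C ℓ
          = (C j)ᴴ * ((x j)ᴴ * x ℓ + 1) * C ℓ := by
        simp only [Matrix.conjTranspose_mul, Matrix.mul_assoc, Matrix.mul_add, Matrix.add_mul,
          Matrix.one_mul]
      rw [e]
      by_cases hj : j = ℓ
      · subst hj
        rw [if_pos rfl, hn]
      · rw [if_neg hj, hx j ℓ hj]
        simp
    · intro j
      rw [hb]; exact hC j
    · intro j
      rw [affine, hb, hs, Matrix.mul_assoc, Matrix.mul_nonsing_inv _ (hC j), Matrix.mul_one]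
end

section
/- The set D_m of unitary n×n matrices all of whose bottom-row m×m blocks are invertible is an open and dense subset of the unitary group U(n) (with the subspace topology inherited from the space of n×n complex matrices). -/
open Matrix

lemma exists_invol {N : Type*} [DecidableEq N] (S T : Finset N) (h : S.card = T.card) :
    ∃ σ : N → N, Function.Involutive σ ∧ ∀ x ∈ T, σ x ∈ S := by
  have h' : (S \ T).card = (T \ S).card := by
    have h1 := Finset.card_sdiff_add_card_inter S T
    have h2 := Finset.card_sdiff_add_card_inter T S
    rw [Finset.inter_comm] at h2
    omega
  let e := Finset.equivOfCardEq h'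
  have he : ∀ x, (e x : N) ∈ T ∧ (e x : N) ∉ S := fun x => Finset.mem_sdiff.1 (e x).2
  have he' : ∀ x, (e.symm x : N) ∈ S ∧ (e.symm x : N) ∉ T := fun x => Finset.mem_sdiff.1 (e.symm x).2
  refine ⟨fun x => if hx : x ∈ S \ T then e ⟨x, hx⟩ else
    if hx : x ∈ T \ S then e.symm ⟨x, hx⟩ else x, ?_, ?_⟩
  · intro x
    by_cases h1 : x ∈ S \ T
    · have := he ⟨x, h1⟩
      have a : (e ⟨x, h1⟩ : N) ∉ S \ T := fun h => this.2 (Finset.mem_sdiff.1 h).1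
      simp only [h1, dif_pos, a, dif_neg, not_false_iff, (e ⟨x, h1⟩).2, Subtype.coe_eta,
        Equiv.symm_apply_apply]
    · by_cases h2 : x ∈ T \ S
      · simp only [h1, dif_pos, dif_neg, not_false_iff, h2, (e.symm ⟨x, h2⟩).2, Subtype.coe_eta,
          Equiv.apply_symm_apply]
      · simp only [h1, h2, dif_neg, not_false_iff]
  · intro x hx
    by_cases h2 : x ∈ S
    · have a : x ∉ S \ T := by simp [hx]
      have b : x ∉ T \ S := by simp [h2]
      simp only [a, b, dif_neg, not_false_iff, h2]
    · have a : x ∉ S \ T := by simp [hx]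
      have b : x ∈ T \ S := by simp [h2, hx]
      simp only [a, b, dif_neg, dif_pos, not_false_iff]
      exact (he' _).1

lemma exists_rows {N : Type*} [Fintype N] [DecidableEq N] {m : ℕ}
    (C : Matrix N (Fin m) ℂ) (hC : Cᴴ * C = 1) :
    ∃ s : Fin m → N, LinearIndependent ℂ (fun a => C (s a)) := by
  have hr : C.rank = m := by
    apply le_antisymm
    · simpa using C.rank_le_card_width
    · have := rank_mul_le_right Cᴴ C
      rw [hC] at this
      simpa using this
  rw [rank_eq_finrank_span_row] at hr
  obtain ⟨f, hf, -, hli⟩ := Submodule.exists_fun_fin_finrank_span_eq ℂ (Set.range C.row)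
  choose g hg using hf
  refine ⟨fun a => g (Fin.cast hr.symm a), ?_⟩
  have h2 := hli.comp _ (Fin.cast_injective hr.symm)
  have h3 : (fun a => C (g (Fin.cast hr.symm a))) = f ∘ Fin.cast hr.symm := by
    funext a
    exact hg _
  rw [h3]
  exact h2

lemma exists_good_invol {k m : ℕ} (U : Matrix (Fin (k+1) × Fin m) (Fin (k+1) × Fin m) ℂ)
    (hU : Uᴴ * U = 1) (l j : Fin (k+1)) :
    ∃ σ : Fin (k+1) × Fin m → Fin (k+1) × Fin m, Function.Involutive σ ∧
      (blk (U.submatrix σ id) l j).det ≠ 0 := by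
  obtain ⟨s, hs⟩ := exists_rows (U.submatrix id (fun b => (j, b))) (by
    ext a b
    have := congrFun (congrFun hU (j, a)) (j, b)
    simpa [Matrix.mul_apply, Matrix.one_apply] using this)
  have hsi : Function.Injective s := fun a b hab => hs.injective (by simp only [hab])
  have hti : Function.Injective (fun a : Fin m => (l, a)) := fun a b hab => by simpa using hab
  obtain ⟨σ, hσ, hST⟩ := exists_invol (Finset.univ.image s)
    (Finset.univ.image (fun a : Fin m => (l, a)))
    (by rw [Finset.card_image_of_injective _ hsi, Finset.card_image_of_injective _ hti])
  refine ⟨σ, hσ, ?_⟩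
  have : ∀ a : Fin m, ∃ b, s b = σ (l, a) := fun a => by
    simpa using hST (l, a) (by simp)
  choose g hg using this
  have hgi : Function.Injective g := fun a b hab => by
    have : σ (l, a) = σ (l, b) := by rw [← hg, ← hg, hab]
    simpa using hσ.injective this
  have h2 := hs.comp g hgi
  rw [← isUnit_iff_ne_zero, ← Matrix.isUnit_iff_isUnit_det,
    ← linearIndependent_rows_iff_isUnit]
  have h3 : (blk (U.submatrix σ id) l j).row =
      (fun a => U.submatrix id (fun b => (j, b)) (s a)) ∘ g := by
    funext a b
    simp [blk, hg, Matrix.row]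
  rw [h3]
  exact h2

lemma path_unitary {N : Type*} [Fintype N] [DecidableEq N] (U : Matrix N N ℂ) (hU : Uᴴ * U = 1)
    (σ : N → N) (hσ : Function.Involutive σ) (t : ℝ) :
    ((Real.cos t : ℂ) • U + (Complex.I * (Real.sin t : ℂ)) • U.submatrix σ id)ᴴ *
      ((Real.cos t : ℂ) • U + (Complex.I * (Real.sin t : ℂ)) • U.submatrix σ id) = 1 := by
  have h1 : (U.submatrix σ id)ᴴ * U.submatrix σ id = 1 := by
    rw [← hU]
    ext a b
    simp only [Matrix.mul_apply, conjTranspose_apply, submatrix_apply, id]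
    exact Equiv.sum_comp (hσ.toPerm σ) (fun x => star (U x a) * U x b)
  have h2 : (U.submatrix σ id)ᴴ * U = Uᴴ * U.submatrix σ id := by
    ext a b
    simp only [Matrix.mul_apply, conjTranspose_apply, submatrix_apply, id]
    rw [← Equiv.sum_comp (hσ.toPerm σ)]
    simp [hσ _]
  have h3 : (Real.cos t : ℂ) * Real.cos t + (Real.sin t : ℂ) * Real.sin t = 1 := by
    norm_cast
    nlinarith [Real.sin_sq_add_cos_sq t]
  simp only [conjTranspose_add, conjTranspose_smul, add_mul, mul_add, smul_mul_smul_comm, hU, h1, h2]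
  have e1 : star (Real.cos t : ℂ) = Real.cos t := Complex.conj_ofReal _
  have e2 : star (Complex.I * (Real.sin t : ℂ)) = -(Complex.I * Real.sin t) := by
    rw [star_mul']
    change (starRingEnd ℂ) _ * (starRingEnd ℂ) _ = _
    rw [Complex.conj_ofReal, Complex.conj_I, neg_mul]
  rw [e1, e2]
  have e3 : -(Complex.I * (Real.sin t : ℂ)) * (Complex.I * Real.sin t) =
      Real.sin t * Real.sin t := by
    linear_combination (-(Real.sin t : ℂ) * Real.sin t) * Complex.I_mul_I
  rw [e3]
  conv_rhs => rw [← one_smul ℂ (1 : Matrix N N ℂ), ← h3]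
  module

lemma det_path {m : ℕ} (B D : Matrix (Fin m) (Fin m) ℂ) (hD : D.det ≠ 0) :
    ∀ᶠ t : ℝ in nhdsWithin 0 {0}ᶜ,
      ((Real.cos t : ℂ) • B + (Complex.I * (Real.sin t : ℂ)) • D).det ≠ 0 := by
  have hc : ∀ x : ℝ, AnalyticAt ℝ (fun t : ℝ => (Real.cos t : ℂ)) x := fun x =>
    (Complex.ofRealCLM.analyticAt _).comp Real.analyticAt_cos
  have hs : ∀ x : ℝ, AnalyticAt ℝ (fun t : ℝ => (Real.sin t : ℂ)) x := fun x =>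
    (Complex.ofRealCLM.analyticAt _).comp Real.analyticAt_sin
  have hf : AnalyticOnNhd ℝ (fun t : ℝ =>
      ((Real.cos t : ℂ) • B + (Complex.I * (Real.sin t : ℂ)) • D).det) Set.univ := by
    intro x _
    simp only [Matrix.det_apply', Matrix.add_apply, Matrix.smul_apply, smul_eq_mul]
    refine Finset.analyticAt_fun_sum _ fun p _ => analyticAt_const.mul ?_
    refine Finset.analyticAt_fun_prod _ fun i _ => ?_
    exact ((hc x).mul analyticAt_const).add ((analyticAt_const.mul (hs x)).mul analyticAt_const)
  rcases (hf 0 trivial).eventually_eq_zero_or_eventually_ne_zero with h | h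
  · exfalso
    have := hf.eqOn_zero_of_preconnected_of_eventuallyEq_zero isPreconnected_univ
      (Set.mem_univ 0) h (Set.mem_univ (Real.pi / 2))
    simp [Matrix.det_smul, hD] at this
  · exact h

lemma isOpen_one (k m : ℕ) (j : Fin (k+1)) :
    IsOpen {U : {U : Matrix (Fin (k+1) × Fin m) (Fin (k+1) × Fin m) ℂ // Uᴴ * U = 1} |
        IsUnit (blk U.1 (Fin.last k) j).det} := by
  simp only [isUnit_iff_ne_zero]
  refine isOpen_ne_fun ?_ continuous_const
  refine Continuous.matrix_det ?_
  refine continuous_matrix fun a b => ?_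
  exact continuous_subtype_val.matrix_elem _ _

lemma dense_one (k m : ℕ) (j : Fin (k+1)) :
    Dense {U : {U : Matrix (Fin (k+1) × Fin m) (Fin (k+1) × Fin m) ℂ // Uᴴ * U = 1} |
        IsUnit (blk U.1 (Fin.last k) j).det} := by
  rintro ⟨U, hU⟩
  obtain ⟨σ, hσ, hD⟩ := exists_good_invol U hU (Fin.last k) j
  let γ : ℝ → {U : Matrix (Fin (k+1) × Fin m) (Fin (k+1) × Fin m) ℂ // Uᴴ * U = 1} :=
    fun t => ⟨_, path_unitary U hU σ hσ t⟩
  have hγ : Continuous γ := by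
    refine Continuous.subtype_mk ?_ _
    have := Complex.continuous_ofReal.comp Real.continuous_cos
    have := Complex.continuous_ofReal.comp Real.continuous_sin
    fun_prop
  have h0 : γ 0 = ⟨U, hU⟩ := by
    apply Subtype.ext
    simp [γ]
  have ht : Filter.Tendsto γ (nhdsWithin 0 {0}ᶜ) (nhds ⟨U, hU⟩) := by
    rw [← h0]
    exact hγ.continuousAt.tendsto.mono_left nhdsWithin_le_nhds
  refine mem_closure_of_tendsto ht ?_
  filter_upwards [det_path (blk U (Fin.last k) j) _ hD] with t h
  exact isUnit_iff_ne_zero.2 h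

lemma dense_finset {X ι : Type*} [TopologicalSpace X] (f : ι → Set X) (ho : ∀ i, IsOpen (f i))
    (hd : ∀ i, Dense (f i)) (s : Finset ι) : Dense (⋂ i ∈ s, f i) := by
  classical
  induction s using Finset.induction_on with
  | empty => simp
  | insert a s _ ih =>
    rw [Finset.set_biInter_insert]
    exact (hd a).inter_of_isOpen_left ih (ho a)

/-- The set `D_m` of unitary matrices with all bottom-row blocks invertible is
open and dense in the unitary group `U(n)` (with the subspace topology). -/
theorem Dm_isOpen_and_dense (k m : ℕ) (hk : 1 ≤ k) (hm : 1 ≤ m) :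
    IsOpen {U : {U : Matrix (Fin (k+1) × Fin m) (Fin (k+1) × Fin m) ℂ // Uᴴ * U = 1} |
        ∀ j, IsUnit (blk U.1 (Fin.last k) j).det} ∧
    Dense {U : {U : Matrix (Fin (k+1) × Fin m) (Fin (k+1) × Fin m) ℂ // Uᴴ * U = 1} |
        ∀ j, IsUnit (blk U.1 (Fin.last k) j).det} := by
  rw [Set.ofPred_forall]
  refine ⟨isOpen_iInter_of_finite fun j => isOpen_one k m j, ?_⟩
  simpa using dense_finset _ (isOpen_one k m) (dense_one k m) Finset.univ
end

section
/- Let U ∈ D_m with affine coordinates p(U) = (w_1,…,w_{k+1}), and set Λ_j := (I_m + w_j* w_j)⁻¹ for j = 1,…,k+1. Then each Λ_j is Hermitian positive definite, Λ_j = U_{(k+1)j}·(U_{(k+1)j})*, and ∑_{j=1}^{k+1} Λ_j = I_m; in particular (Λ_1,…,Λ_{k+1}) belongs to the simplex of Hermitian matrices T_n^m. -/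
open Matrix ComplexOrder

/-- For `U ∈ D_m` with affine coordinates `w`, the matrices
`Λ_j = (I_m + w_j* w_j)⁻¹` are Hermitian positive definite, equal
`U_{(k+1)j} U_{(k+1)j}*`, and sum to `I_m`; in particular
`(Λ_1,…,Λ_{k+1})` lies in the simplex of Hermitian matrices `T_n^m`. -/
theorem radial_in_simplex (k m : ℕ) (hk : 1 ≤ k) (hm : 1 ≤ m)
    (U : Matrix (Fin (k+1) × Fin m) (Fin (k+1) × Fin m) ℂ)
    (hU : Uᴴ * U = 1)
    (hUd : ∀ j, IsUnit (blk U (Fin.last k) j).det) :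
    (∀ j, (((1 : Matrix (Fin m) (Fin m) ℂ) + (affine U j)ᴴ * affine U j)⁻¹).PosDef) ∧
    (∀ j, ((1 : Matrix (Fin m) (Fin m) ℂ) + (affine U j)ᴴ * affine U j)⁻¹ =
        blk U (Fin.last k) j * (blk U (Fin.last k) j)ᴴ) ∧
    (∀ j, (((1 : Matrix (Fin m) (Fin m) ℂ) + (affine U j)ᴴ * affine U j)⁻¹).PosSemidef) ∧
    ∑ j : Fin (k+1),
        ((1 : Matrix (Fin m) (Fin m) ℂ) + (affine U j)ᴴ * affine U j)⁻¹ = 1 := by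
  have key : ∀ j, (stk U j)ᴴ * stk U j
      + (blk U (Fin.last k) j)ᴴ * blk U (Fin.last k) j = 1 := by
    intro j
    ext a b
    have h := congrFun (congrFun hU (j, a)) (j, b)
    rw [Matrix.mul_apply, Fintype.sum_prod_type, Fin.sum_univ_castSucc] at h
    rw [Matrix.add_apply, Matrix.mul_apply, Matrix.mul_apply, Fintype.sum_prod_type]
    have h1 : (1 : Matrix (Fin (k+1) × Fin m) (Fin (k+1) × Fin m) ℂ) (j, a) (j, b)
        = (1 : Matrix (Fin m) (Fin m) ℂ) a b := by
      simp [Matrix.one_apply]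
    rw [h1] at h
    exact h
  have eqn : ∀ j, ((1 : Matrix (Fin m) (Fin m) ℂ) + (affine U j)ᴴ * affine U j)⁻¹ =
        blk U (Fin.last k) j * (blk U (Fin.last k) j)ᴴ := by
    intro j
    have hk' := key j
    have hu := hUd j
    unfold affine
    generalize blk U (Fin.last k) j = B at *
    generalize stk U j = S at *
    have hB : B * B⁻¹ = 1 := Matrix.mul_nonsing_inv B hu
    have hB2 : B⁻¹ * B = 1 := Matrix.nonsing_inv_mul B hu
    have hB' : (B⁻¹)ᴴ * Bᴴ = 1 := by rw [← conjTranspose_mul, hB, conjTranspose_one]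
    have e : (1 : Matrix (Fin m) (Fin m) ℂ) + (S * B⁻¹)ᴴ * (S * B⁻¹) = (B⁻¹)ᴴ * B⁻¹ := by
      calc _ = ((B⁻¹)ᴴ * Bᴴ) * (B * B⁻¹) + (S * B⁻¹)ᴴ * (S * B⁻¹) := by
            rw [hB, hB', one_mul]
        _ = (B⁻¹)ᴴ * (Sᴴ * S + Bᴴ * B) * B⁻¹ := by
            rw [conjTranspose_mul, Matrix.mul_add, Matrix.add_mul, add_comm]
            simp only [Matrix.mul_assoc]
        _ = _ := by rw [hk', Matrix.mul_one]
    rw [e]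
    apply Matrix.inv_eq_right_inv
    calc (B⁻¹)ᴴ * B⁻¹ * (B * Bᴴ) = (B⁻¹)ᴴ * (B⁻¹ * B) * Bᴴ := by
          simp only [Matrix.mul_assoc]
      _ = 1 := by rw [hB2, Matrix.mul_one, hB']
  have pd : ∀ j, (((1 : Matrix (Fin m) (Fin m) ℂ)
      + (affine U j)ᴴ * affine U j)⁻¹).PosDef := by
    intro j
    exact (Matrix.PosDef.one.add_posSemidef
      (Matrix.posSemidef_conjTranspose_mul_self (affine U j))).inv
  refine ⟨pd, eqn, fun j => (pd j).posSemidef, ?_⟩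
  simp only [eqn]
  have hU' : U * Uᴴ = 1 := mul_eq_one_comm.mp hU
  ext a b
  have h := congrFun (congrFun hU' (Fin.last k, a)) (Fin.last k, b)
  rw [Matrix.mul_apply, Fintype.sum_prod_type] at h
  have h1 : (1 : Matrix (Fin (k+1) × Fin m) (Fin (k+1) × Fin m) ℂ)
      (Fin.last k, a) (Fin.last k, b) = (1 : Matrix (Fin m) (Fin m) ℂ) a b := by
    simp [Matrix.one_apply]
  rw [h1] at h
  rw [Matrix.sum_apply]
  exact h
end
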